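/- There exists an open dense subset O of SU(4) such that for every g ∈ O, writing g' = S g S (which again lies in SU(4)), the image in the quotient group PU(4) = SU(4)/Z(SU(4)) (equipped with the quotient topology) of the subgroup of SU(4) generated by {g, g'} is dense in PU(4). -/

import Mathlib

open Matrix

/-- The Swap matrix on ℂ² ⊗ ℂ² ≅ ℂ⁴. -/
noncomputable def S : Matrix (Fin 4) (Fin 4) ℂ :=
  !![1,0,0,0; 0,0,1,0; 0,1,0,0; 0,0,0,1]

/-- SU(4): the 4×4 complex unitary matrices of determinant 1, realized as the subgroup
of the unitary group `Matrix.unitaryGroup (Fin 4) ℂ` cut out by `det = 1`. -/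
def SU4 : Subgroup ↥(Matrix.unitaryGroup (Fin 4) ℂ) where
  carrier := {g | ((g : Matrix (Fin 4) (Fin 4) ℂ)).det = 1}
  mul_mem' := by
    intro a b ha hb
    simp only [Set.mem_setOf_eq] at *
    rw [Submonoid.coe_mul, det_mul, ha, hb, one_mul]
  one_mem' := by
    simp only [Set.mem_setOf_eq, OneMemClass.coe_one, det_one]
  inv_mem' := by
    intro a ha
    simp only [Set.mem_setOf_eq] at *
    have h : ((a⁻¹ : ↥(Matrix.unitaryGroup (Fin 4) ℂ)) : Matrix (Fin 4) (Fin 4) ℂ) *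
        (a : Matrix (Fin 4) (Fin 4) ℂ) = 1 := by
      rw [← Submonoid.coe_mul]
      norm_cast
      rw [inv_mul_cancel]
      rfl
    have := congrArg Matrix.det h
    rw [det_mul, ha, mul_one, det_one] at this
    exact this

/-- The coercion of an element of SU4 to a 4×4 complex matrix. -/
def toMat (g : ↥SU4) : Matrix (Fin 4) (Fin 4) ℂ := ((g : ↥(Matrix.unitaryGroup (Fin 4) ℂ)) : Matrix (Fin 4) (Fin 4) ℂ)

/-- PU(4) = SU(4)/Z(SU(4)) with the quotient topology. -/
abbrev PU4 := ↥SU4 ⧸ Subgroup.center ↥SU4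


section
open scoped Matrix.Norms.L2Operator
open Filter Topology NormedSpace

abbrev M4 := Matrix (Fin 4) (Fin 4) ℂ

noncomputable local instance instNormedAlgebraRatM4 : NormedAlgebra ℚ M4 := .restrictScalars ℚ ℂ M4

noncomputable local instance instNormedAlgebraRealM4 : NormedAlgebra ℝ M4 := .restrictScalars ℝ ℂ M4

theorem u_left {V : M4} (hV : V ∈ unitary M4) : star V * V = 1 := hV.1
theorem u_right {V : M4} (hV : V ∈ unitary M4) : V * star V = 1 := hV.2

theorem exp_conj_unitary {V : M4} (hV : V ∈ unitary M4) (X : M4) :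
    exp (V * X * star V) = V * exp X * star V := by
  have h : V⁻¹ = star V := Matrix.inv_eq_right_inv hV.2
  have hu : IsUnit V := ⟨⟨V, star V, hV.2, hV.1⟩, rfl⟩
  have := Matrix.exp_conj V X hu
  rwa [h] at this

theorem exp_diag (v : Fin 4 → ℂ) :
    exp (diagonal v : M4) = diagonal (fun i => Complex.exp (v i)) := by
  rw [Matrix.exp_diagonal]
  congr 1
  ext i
  rw [Pi.coe_exp, Complex.exp_eq_exp_ℂ]

/-- Every unitary matrix is unitarily diagonalizable, with eigenvalues `exp (i θ)`. -/
theorem exists_diag {U : M4} (hU : U ∈ unitary M4) :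
    ∃ V ∈ unitary M4, ∃ θ : Fin 4 → ℝ,
      U = V * diagonal (fun i => Complex.exp (Complex.I * θ i)) * star V := by
  -- choose `z` on the circle away from the spectrum
  obtain ⟨a, ha⟩ : ∃ a : ℝ, -Complex.exp (Complex.I * a) ∉ spectrum ℂ U := by
    by_contra hcon
    push Not at hcon
    have hfin : (spectrum ℂ U).Finite := Matrix.finite_spectrum U
    have hinj : Set.InjOn (fun a : ℝ => -Complex.exp (Complex.I * a)) (Set.Ioo 0 1) := by
      intro x hx y hy hxy
      simp only [neg_inj] at hxy
      have := Complex.exp_inj_of_neg_pi_lt_of_le_pi (x := Complex.I * x) (y := Complex.I * y)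
        (by simp; linarith [hx.1, Real.pi_pos]) (by simp; linarith [hx.2, Real.pi_gt_three])
        (by simp; linarith [hy.1, Real.pi_pos]) (by simp; linarith [hy.2, Real.pi_gt_three]) hxy
      simpa using this
    have := Set.Finite.of_finite_image (hfin.subset (by
      rintro _ ⟨x, -, rfl⟩; exact hcon x)) hinj
    exact (Set.Ioo_infinite (zero_lt_one' ℝ)) this
  set z : ℂ := Complex.exp (Complex.I * a) with hz
  set z' : ℂ := Complex.exp (-(Complex.I * a)) with hz'
  have hzz : z * z' = 1 := by rw [hz, hz', ← Complex.exp_add]; simp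
  have hst : star z' = z := by
    rw [hz, hz', Complex.star_def, ← Complex.exp_conj]; simp
  have hu' : z' • U ∈ unitary M4 := by
    constructor
    · rw [star_smul, hst, smul_mul_smul_comm, hU.1, hzz, one_smul]
    · rw [star_smul, hst, smul_mul_smul_comm, hU.2, mul_comm, hzz, one_smul]
  have hlt : ‖z' • U - 1‖ < 2 := by
    rw [Unitary.norm_sub_one_lt_two_iff hu']
    intro hmem
    have hzu : (Units.mk z' z (by rw [mul_comm, hzz]) hzz) • U = z' • U := rfl
    rw [← hzu, spectrum.unit_smul_eq_smul, Set.mem_smul_set] at hmem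
    obtain ⟨y, hy, hy2⟩ := hmem
    have hy3 : z' * y = -1 := hy2
    have : y = - z := by
      calc y = z * z' * y := by rw [hzz, one_mul]
        _ = z * (z' * y) := by ring
        _ = - z := by rw [hy3]; ring
    exact ha (this ▸ hy)
  obtain ⟨A, hA⟩ : ∃ A : selfAdjoint M4, (selfAdjoint.expUnitary A : M4) = z' • U :=
    ⟨_, congrArg Subtype.val (_root_.expUnitary_argSelfAdjoint (u := ⟨_, hu'⟩) hlt)⟩
  rw [selfAdjoint.expUnitary_coe] at hA
  have hH : (A : M4).IsHermitian := A.2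
  refine ⟨hH.eigenvectorUnitary, hH.eigenvectorUnitary.2, fun i => a + hH.eigenvalues i, ?_⟩
  have hs := hH.spectral_theorem
  rw [Unitary.conjStarAlgAut_apply] at hs
  set V : M4 := (hH.eigenvectorUnitary : M4) with hV
  have hVu : V ∈ unitary M4 := hH.eigenvectorUnitary.2
  have h1 : Complex.I • (A : M4) =
      V * diagonal (fun i => Complex.I * (hH.eigenvalues i : ℂ)) * star V := by
    conv_lhs => rw [hs]
    rw [← smul_mul_assoc, ← mul_smul_comm, ← diagonal_smul]
    rfl
  rw [h1, exp_conj_unitary hVu, exp_diag] at hA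
  have h2 : U = z • (z' • U) := by rw [smul_smul, hzz, one_smul]
  rw [h2, ← hA, ← smul_mul_assoc, ← mul_smul_comm, ← diagonal_smul]
  congr 3
  ext i
  simp only [Pi.smul_apply, smul_eq_mul, hz, ← Complex.exp_add]
  push_cast
  ring_nf

theorem exp_log_diag {V : M4} (hV : V ∈ unitary M4) (θ : Fin 4 → ℝ) :
    V * diagonal (fun i => Complex.exp (Complex.I * θ i)) * star V =
      exp (V * diagonal (fun i => Complex.I * (θ i : ℂ)) * star V) := by
  rw [exp_conj_unitary hV, exp_diag]

theorem skew_diag (V : M4) (θ : Fin 4 → ℝ) :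
    star (V * diagonal (fun i => Complex.I * (θ i : ℂ)) * star V) =
      -(V * diagonal (fun i => Complex.I * (θ i : ℂ)) * star V) := by
  rw [star_mul, star_mul, star_star, ← mul_assoc]
  rw [star_eq_conjTranspose (diagonal _), diagonal_conjTranspose]
  have : star (fun i => Complex.I * (θ i : ℂ)) = -(fun i => Complex.I * (θ i : ℂ)) := by
    ext i; simp
  have h2 : (diagonal (-(fun i => Complex.I * (θ i : ℂ))) : M4) =
      -diagonal (fun i => Complex.I * (θ i : ℂ)) := (diagonal_neg _).symm
  rw [this, h2, mul_neg, neg_mul]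

theorem exists_log {U : M4} (hU : U ∈ unitary M4) :
    ∃ X : M4, star X = -X ∧ exp X = U := by
  obtain ⟨V, hV, θ, h⟩ := exists_diag hU
  exact ⟨_, skew_diag V θ, by rw [h, ← exp_log_diag hV]⟩

theorem exists_log_trace {U : M4} (hU : U ∈ unitary M4) (hd : U.det = 1) :
    ∃ X : M4, star X = -X ∧ X.trace = 0 ∧ exp X = U := by
  obtain ⟨V, hV, θ, h⟩ := exists_diag hU
  have hdet : ∏ i, Complex.exp (Complex.I * θ i) = 1 := by
    have h1 := congrArg Matrix.det h
    rw [hd, det_mul, mul_comm, ← det_mul, ← mul_assoc, hV.1, one_mul, det_diagonal] at h1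
    exact h1.symm
  rw [← Complex.exp_sum] at hdet
  set θ' : Fin 4 → ℝ := fun i => if i = 0 then θ 0 - ∑ j, θ j else θ i with hθ'
  refine ⟨_, skew_diag V θ', ?_, ?_⟩
  · rw [Matrix.trace_mul_comm, ← mul_assoc, hV.1, one_mul, trace_diagonal, ← Finset.mul_sum]
    simp only [Fin.sum_univ_four, hθ']
    simp
    ring
  · rw [← exp_log_diag hV, h]
    congr 3
    ext i
    by_cases hi : i = 0
    · subst hi
      simp only [hθ', if_true]
      push_cast
      rw [mul_sub, Complex.exp_sub, Finset.mul_sum, hdet, div_one]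
    · simp [hθ', hi]

structure ClosedGrp (K : Set M4) : Prop where
  closed : IsClosed K
  one : (1 : M4) ∈ K
  mul : ∀ {a b}, a ∈ K → b ∈ K → a * b ∈ K
  star : ∀ {a}, a ∈ K → star a ∈ K
  unit : ∀ {a}, a ∈ K → a ∈ unitary M4
  det : ∀ {a : M4}, a ∈ K → a.det = 1

theorem ClosedGrp.pow {K : Set M4} (hK : ClosedGrp K) {a : M4} (ha : a ∈ K) (n : ℕ) :
    a ^ n ∈ K := by
  induction n with
  | zero => simpa using hK.one
  | succ n ih => rw [pow_succ]; exact hK.mul ih ha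

theorem norm_u {V : M4} (hV : V ∈ unitary M4) : ‖V‖ = 1 := CStarRing.norm_of_mem_unitary hV

theorem norm_pow_sub_pow {a b : M4} (ha : a ∈ unitary M4) (hb : b ∈ unitary M4) (n : ℕ) :
    ‖a ^ n - b ^ n‖ ≤ n * ‖a - b‖ := by
  induction n with
  | zero => simp
  | succ n ih =>
    have : a ^ (n+1) - b ^ (n+1) = a ^ n * (a - b) + (a ^ n - b ^ n) * b := by
      rw [pow_succ, pow_succ]; noncomm_ring
    rw [this]
    calc _ ≤ ‖a ^ n * (a - b)‖ + ‖(a ^ n - b ^ n) * b‖ := norm_add_le _ _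
      _ ≤ ‖a ^ n‖ * ‖a - b‖ + ‖a ^ n - b ^ n‖ * ‖b‖ :=
        add_le_add (norm_mul_le _ _) (norm_mul_le _ _)
      _ ≤ 1 * ‖a - b‖ + (n * ‖a - b‖) * 1 := by
        rw [norm_u hb, norm_u (pow_mem ha n)]
        gcongr
      _ = _ := by push_cast; ring

theorem skew_smul {X : M4} (hX : star X = -X) (s : ℝ) : star (s • X) = -(s • X) := by
  rw [star_smul, hX]; simp

theorem exp_skew_mem {X : M4} (hX : star X = -X) : exp X ∈ unitary M4 :=
  NormedSpace.exp_mem_unitary_of_mem_skewAdjoint (skewAdjoint.mem_iff.mpr hX)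

theorem tendsto_exp_slope (X : M4) {t : ℕ → ℝ} (ht0 : ∀ n, 0 < t n) (ht : Tendsto t atTop atTop) :
    Tendsto (fun n => t n • (exp ((t n)⁻¹ • X) - 1)) atTop (𝓝 X) := by
  have h := (hasDerivAt_exp_smul_const (𝕂 := ℝ) X 0).tendsto_slope_zero
  simp only [zero_smul, exp_zero, one_mul, zero_add] at h
  have h2 : Tendsto (fun n => (t n)⁻¹) atTop (𝓝[≠] 0) := by
    rw [tendsto_nhdsWithin_iff]
    refine ⟨tendsto_inv_atTop_zero.comp ht, Eventually.of_forall fun n => ?_⟩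
    simpa using (ht0 n).ne'
  have := h.comp h2
  simpa [Function.comp_def] using this

theorem key_limit {K : Set M4} (hK : ClosedGrp K) {h : ℕ → M4} (hh : ∀ n, h n ∈ K) {t : ℕ → ℝ}
    (ht0 : ∀ n, 0 < t n) (ht : Tendsto t atTop atTop) {X : M4}
    (hX : Tendsto (fun n => t n • (h n - 1)) atTop (𝓝 X)) :
    star X = -X ∧ ∀ s : ℝ, exp (s • X) ∈ K := by
  have h1 : Tendsto (fun n => h n - 1) atTop (𝓝 0) := by
    have := (tendsto_inv_atTop_zero.comp ht).smul hX
    rw [zero_smul] at this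
    refine this.congr fun n => ?_
    simp [smul_smul, inv_mul_cancel₀ (ht0 n).ne']
  have hskew : star X = -X := by
    have e1 : Tendsto (fun n => t n • (h n - 1) + star (t n • (h n - 1))) atTop
        (𝓝 (X + star X)) := hX.add (hX.star)
    have e2 : Tendsto (fun n => -(star (t n • (h n - 1)) * (h n - 1))) atTop
        (𝓝 (-(star X * 0))) := (hX.star.mul h1).neg
    have e3 : X + star X = -(star X * 0) := by
      refine tendsto_nhds_unique (e1.congr fun n => ?_) e2
      have hu := (hK.unit (hh n)).1
      have : star (h n - 1) * (h n - 1) = -((h n - 1) + star (h n - 1)) := by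
        rw [star_sub, star_one, sub_mul, mul_sub, hu]; noncomm_ring
      rw [star_smul, smul_mul_assoc, this]
      rw [star_trivial, smul_neg, neg_neg, smul_add]
    rw [mul_zero, neg_zero] at e3
    exact eq_neg_of_add_eq_zero_right e3
  refine ⟨hskew, ?_⟩
  have hpos : ∀ s : ℝ, 0 ≤ s → exp (s • X) ∈ K := by
    intro s hs
    set E : ℕ → M4 := fun n => exp ((t n)⁻¹ • X) with hE
    set m : ℕ → ℕ := fun n => ⌊s * t n⌋₊ with hm
    have hEu : ∀ n, E n ∈ unitary M4 := fun n => exp_skew_mem (skew_smul hskew _)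
    have d1 : Tendsto (fun n => s * ‖t n • (h n - E n)‖) atTop (𝓝 0) := by
      have := hX.sub (tendsto_exp_slope X ht0 ht)
      rw [sub_self] at this
      have := (this.norm).const_mul s
      rw [norm_zero, mul_zero] at this
      refine this.congr fun n => ?_
      rw [← smul_sub]; simp [hE]
    have d2 : Tendsto (fun n => h n ^ m n - E n ^ m n) atTop (𝓝 0) := by
      refine squeeze_zero_norm (fun n => ?_) d1
      refine (norm_pow_sub_pow (hK.unit (hh n)) (hEu n) _).trans ?_
      rw [norm_smul, Real.norm_eq_abs, abs_of_pos (ht0 n), ← mul_assoc]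
      gcongr
      exact Nat.floor_le (mul_nonneg hs (ht0 n).le)
    have d3 : Tendsto (fun n => E n ^ m n) atTop (𝓝 (exp (s • X))) := by
      have f1 : Tendsto (fun n => (m n : ℝ) / t n) atTop (𝓝 s) :=
        (tendsto_nat_floor_mul_div_atTop hs).comp ht
      have f2 : Continuous (fun r : ℝ => exp (r • X)) :=
        NormedSpace.exp_continuous.comp (by fun_prop)
      refine ((f2.tendsto s).comp f1).congr fun n => ?_
      simp only [Function.comp, hE]
      rw [← NormedSpace.exp_nsmul, ← Nat.cast_smul_eq_nsmul ℝ, smul_smul, div_eq_mul_inv]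
    have d4 := d2.add d3
    simp only [sub_add_cancel, zero_add] at d4
    exact hK.closed.mem_of_tendsto d4 (Eventually.of_forall fun n => hK.pow (hh n) _)
  intro s
  rcases le_total 0 s with hs | hs
  · exact hpos s hs
  · have := hK.star (hpos (-s) (by linarith))
    rw [star_exp, star_smul, hskew] at this
    simpa using this

/-- The Lie algebra of a closed group of matrices. -/
def lieSub {K : Set M4} (hK : ClosedGrp K) : Submodule ℝ M4 where
  carrier := {X | star X = -X ∧ ∀ s : ℝ, exp (s • X) ∈ K}
  zero_mem' := by
    refine ⟨by simp, fun s => ?_⟩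
    simpa using hK.one
  smul_mem' := by
    rintro c X ⟨h1, h2⟩
    refine ⟨skew_smul h1 c, fun s => ?_⟩
    rw [smul_smul]; exact h2 _
  add_mem' := by
    rintro X Y ⟨hX, hX2⟩ ⟨hY, hY2⟩
    have ht0 : ∀ n : ℕ, (0:ℝ) < (n : ℝ) + 1 := fun n => by positivity
    have ht : Tendsto (fun n : ℕ => (n : ℝ) + 1) atTop atTop :=
      tendsto_atTop_add_const_right _ _ tendsto_natCast_atTop_atTop
    have eX := tendsto_exp_slope X ht0 ht
    have eY := tendsto_exp_slope Y ht0 ht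
    refine key_limit hK (h := fun n : ℕ => exp (((n : ℝ) + 1)⁻¹ • X) * exp (((n : ℝ) + 1)⁻¹ • Y))
      (fun n => hK.mul (hX2 _) (hY2 _)) ht0 ht ?_
    have eE : Tendsto (fun n : ℕ => exp (((n : ℝ) + 1)⁻¹ • Y)) atTop (𝓝 1) := by
      have f2 : Continuous (fun r : ℝ => exp (r • Y)) :=
        NormedSpace.exp_continuous.comp (by fun_prop)
      have := (f2.tendsto 0).comp (tendsto_inv_atTop_zero.comp ht)
      simpa [Function.comp_def] using this
    have := (eX.mul eE).add eY
    rw [mul_one] at this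
    refine this.congr fun n => ?_
    rw [smul_mul_assoc, ← smul_add]
    congr 1
    noncomm_ring

theorem lieSub_conj {K : Set M4} (hK : ClosedGrp K) {k X : M4} (hk : k ∈ K)
    (hX : X ∈ lieSub hK) : k * X * star k ∈ lieSub hK := by
  refine ⟨?_, fun s => ?_⟩
  · rw [star_mul, star_mul, star_star, hX.1]; noncomm_ring
  · rw [← smul_mul_assoc, ← mul_smul_comm, exp_conj_unitary (hK.unit hk)]
    exact hK.mul (hK.mul hk (hX.2 s)) (hK.star hk)

/-- A scalar element of the Lie algebra vanishes. -/
theorem lieSub_scalar {K : Set M4} (hK : ClosedGrp K) {c : ℂ}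
    (hX : c • (1 : M4) ∈ lieSub hK) : c = 0 := by
  have h : ∀ s : ℝ, Complex.exp (4 * (s * c)) = 1 := by
    intro s
    have h1 := hK.det (hX.2 s)
    have h2 : s • c • (1 : M4) = diagonal (fun _ => (s * c : ℂ)) := by
      ext i j
      simp [Matrix.one_apply, Matrix.diagonal_apply]
    rw [h2, exp_diag, det_diagonal] at h1
    simp only [Finset.prod_const, Finset.card_univ, Fintype.card_fin] at h1
    rw [← Complex.exp_nat_mul] at h1
    exact_mod_cast h1
  have hd : HasDerivAt (fun s : ℝ => Complex.exp (4 * (s * c))) (4 * c) 0 := by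
    have h1 : HasDerivAt (fun s : ℝ => (4 * ((s:ℂ) * c))) (4 * (1 * c)) 0 :=
      ((Complex.ofRealCLM.hasDerivAt).mul_const c).const_mul 4
    have := h1.cexp
    simpa using this
  have hd2 : HasDerivAt (fun s : ℝ => Complex.exp (4 * (s * c))) 0 0 := by
    have : (fun s : ℝ => Complex.exp (4 * (s * c))) = fun _ => 1 := funext h
    rw [this]; exact hasDerivAt_const _ _
  have := hd.unique hd2
  simpa using this

/-- If the identity is a limit of other group elements, the Lie algebra is nonzero. -/
theorem lieSub_nontrivial {K : Set M4} (hK : ClosedGrp K)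
    (hacc : ∀ ε > 0, ∃ h ∈ K, h ≠ 1 ∧ ‖h - 1‖ < ε) : ∃ X ∈ lieSub hK, X ≠ 0 := by
  choose h hhK hne hlt using fun n : ℕ => hacc (1 / ((n : ℝ) + 1)) (by positivity)
  have hpos : ∀ n, 0 < ‖h n - 1‖ := fun n => norm_pos_iff.mpr (sub_ne_zero.mpr (hne n))
  have hto : Tendsto (fun n => ‖h n - 1‖) atTop (𝓝 0) :=
    squeeze_zero (fun n => norm_nonneg _) (fun n => (hlt n).le) tendsto_one_div_add_atTop_nhds_zero_nat
  have ht : Tendsto (fun n => ‖h n - 1‖⁻¹) atTop atTop := by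
    refine Tendsto.comp tendsto_inv_nhdsGT_zero ?_
    rw [tendsto_nhdsWithin_iff]
    exact ⟨hto, Eventually.of_forall hpos⟩
  have hs : ∀ n, ‖h n - 1‖⁻¹ • (h n - 1) ∈ Metric.sphere (0 : M4) 1 := by
    intro n
    rw [mem_sphere_zero_iff_norm, norm_smul, norm_inv, norm_norm, inv_mul_cancel₀ (hpos n).ne']
  obtain ⟨X, hX, φ, hφ, hlim⟩ := (isCompact_sphere (0 : M4) 1).tendsto_subseq hs
  have := key_limit hK (h := h ∘ φ) (fun n => hhK _) (t := fun n => ‖h (φ n) - 1‖⁻¹)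
    (fun n => inv_pos.mpr (hpos _)) (ht.comp hφ.tendsto_atTop) hlim
  refine ⟨X, this, ?_⟩
  rintro rfl
  simp at hX

/-- The generic conditions on the eigenvalues. -/
def GoodD (N : ℕ) (d : Fin 4 → ℂ) : Prop :=
  (∀ i j k l, i ≠ j → (i, j) ≠ (k, l) → d i * star (d j) ≠ d k * star (d l)) ∧
  (∀ n : ℕ, 1 ≤ n → n ≤ N → ∀ i j, i ≠ j → d i ^ n ≠ d j ^ n)

/-- The generic condition on the eigenvectors. -/
def GoodV (V : M4) : Prop := ∀ i j, (star V * S * V) i j ≠ 0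

/-- Conjugation by a diagonal matrix, as a linear map. -/
def adD (d : Fin 4 → ℂ) : M4 →ₗ[ℂ] M4 where
  toFun A := diagonal d * A * star (diagonal d)
  map_add' := by intros; noncomm_ring
  map_smul' := by intros; simp

theorem adD_apply (d : Fin 4 → ℂ) (A : M4) (i j : Fin 4) :
    adD d A i j = d i * star (d j) * A i j := by
  change (diagonal d * A * star (diagonal d)) i j = _
  rw [star_eq_conjTranspose, diagonal_conjTranspose, mul_diagonal, diagonal_mul]
  simp; ring

theorem adD_aeval (d : Fin 4 → ℂ) (p : Polynomial ℂ) (A : M4) (i j : Fin 4) :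
    (Polynomial.aeval (adD d) p A) i j = p.eval (d i * star (d j)) * A i j := by
  induction p using Polynomial.induction_on' with
  | add p q hp hq => simp [hp, hq, add_mul]
  | monomial n a =>
    rw [Polynomial.aeval_monomial, Polynomial.eval_monomial]
    have : ∀ n : ℕ, ((adD d ^ n) A) i j = (d i * star (d j)) ^ n * A i j := by
      intro n
      induction n with
      | zero => simp
      | succ n ih =>
        rw [pow_succ', Module.End.mul_apply, adD_apply, ih]; ring
    simp only [Module.algebraMap_end_eq_smul_id, Module.End.mul_apply, LinearMap.smul_apply,
      LinearMap.id_apply, Matrix.smul_apply, this, smul_eq_mul]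
    ring

theorem aeval_mem {W : Submodule ℂ M4} {f : M4 →ₗ[ℂ] M4} (hW : ∀ A ∈ W, f A ∈ W)
    (p : Polynomial ℂ) {A : M4} (hA : A ∈ W) : Polynomial.aeval f p A ∈ W := by
  induction p using Polynomial.induction_on' with
  | add p q hp hq => simpa using W.add_mem hp hq
  | monomial n a =>
    rw [Polynomial.aeval_monomial]
    have : ∀ n : ℕ, (f ^ n) A ∈ W := by
      intro n
      induction n with
      | zero => simpa
      | succ n ih => rw [pow_succ', Module.End.mul_apply]; exact hW _ ih
    simpa [Module.algebraMap_end_eq_smul_id] using W.smul_mem a (this n)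

/-- An invariant subspace contains the elementary matrices of its nonzero off-diagonal entries. -/
theorem single_mem {N : ℕ} {d : Fin 4 → ℂ} (hd : GoodD N d) {W : Submodule ℂ M4}
    (hW : ∀ A ∈ W, diagonal d * A * star (diagonal d) ∈ W) {A : M4} (hA : A ∈ W) {i j : Fin 4}
    (hij : i ≠ j) (hne : A i j ≠ 0) : Matrix.single i j (1 : ℂ) ∈ W := by
  set p : Polynomial ℂ := ∏ q ∈ (Finset.univ.erase (i, j) : Finset (Fin 4 × Fin 4)),
    (Polynomial.X - Polynomial.C (d q.1 * star (d q.2))) with hp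
  have h0 : p.eval (d i * star (d j)) ≠ 0 := by
    rw [hp, Polynomial.eval_prod, Finset.prod_ne_zero_iff]
    rintro ⟨k, l⟩ hkl
    simp only [Polynomial.eval_sub, Polynomial.eval_X, Polynomial.eval_C]
    rw [sub_ne_zero]
    exact hd.1 i j k l hij (by simpa [eq_comm] using hkl)
  have h1 : ∀ k l, (k, l) ≠ (i, j) → p.eval (d k * star (d l)) = 0 := by
    intro k l hkl
    rw [hp, Polynomial.eval_prod]
    refine Finset.prod_eq_zero (i := (k, l)) (by simpa using hkl) ?_
    simp
  have h2 : Matrix.single i j (1 : ℂ) =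
      (p.eval (d i * star (d j)) * A i j)⁻¹ • Polynomial.aeval (adD d) p A := by
    ext k l
    rw [Matrix.smul_apply, adD_aeval, smul_eq_mul, Matrix.single_apply]
    by_cases hkl : (k, l) = (i, j)
    · obtain ⟨rfl, rfl⟩ := Prod.mk.inj hkl
      rw [inv_mul_cancel₀ (mul_ne_zero h0 hne)]; simp
    · rw [h1 k l hkl]
      have : ¬ (i = k ∧ j = l) := by rintro ⟨rfl, rfl⟩; exact hkl rfl
      simp [this]
  rw [h2]
  exact W.smul_mem _ (aeval_mem hW p hA)

theorem diag_scalar_of {Q : M4} (hQ : Q * Q = 1) (hne : ∀ i j, Q i j ≠ 0) {c : Fin 4 → ℂ}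
    (hc : ∀ k l, k ≠ l → (Q * diagonal c * Q) k l = 0) : ∀ i j, c i = c j := by
  set c' : Fin 4 → ℂ := fun k => (Q * diagonal c * Q) k k with hc'
  have h1 : Q * diagonal c * Q = diagonal c' := by
    ext k l
    by_cases hkl : k = l
    · subst hkl; simp [hc']
    · rw [hc k l hkl, diagonal_apply_ne _ hkl]
  have h2 : Q * diagonal c = diagonal c' * Q := by
    rw [← h1, mul_assoc, hQ, mul_one]
  have h3 : ∀ i j, c j = c' i := by
    intro i j
    have := congrFun (congrFun h2 i) j
    rw [mul_diagonal, diagonal_mul, mul_comm] at this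
    exact mul_right_cancel₀ (hne i j) this
  intro i j
  rw [h3 0 i, h3 0 j]

theorem mul_single_mul_apply (Q : M4) (i j k l : Fin 4) :
    (Q * Matrix.single i j (1 : ℂ) * Q) k l = Q k i * Q j l := by
  rw [mul_apply, Finset.sum_eq_single j]
  · simp
  · intro b _ hb
    simp [hb]
  · simp

/-- Irreducibility in the eigenbasis. -/
theorem irr_core {N : ℕ} {d : Fin 4 → ℂ} (hd : GoodD N d) {Q : M4} (hQ : Q * Q = 1)
    (hne : ∀ i j, Q i j ≠ 0) {W : Submodule ℂ M4}
    (hW : ∀ A ∈ W, diagonal d * A * star (diagonal d) ∈ W)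
    (hW2 : ∀ A, Q * A * Q ∈ W → Q * (diagonal d * A * star (diagonal d)) * Q ∈ W)
    {B : M4} (hB : B ∈ W) (hBs : ∀ c : ℂ, B ≠ c • 1) {A : M4} (hA : A.trace = 0) : A ∈ W := by
  let f : M4 →ₗ[ℂ] M4 := (LinearMap.mulRight ℂ Q).comp (LinearMap.mulLeft ℂ Q)
  have hf : ∀ A, f A = Q * A * Q := fun A => rfl
  have key2 : ∀ A ∈ W, ∀ i j, i ≠ j → (Q * A * Q) i j ≠ 0 →
      Q * Matrix.single i j (1 : ℂ) * Q ∈ W := by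
    intro A hA i j hij h
    have := single_mem hd (W := W.comap f) (A := Q * A * Q)
      (fun A hA => hW2 A hA) (by
        change Q * (Q * A * Q) * Q ∈ W
        have : Q * (Q * A * Q) * Q = (Q * Q) * A * (Q * Q) := by noncomm_ring
        rw [this, hQ, one_mul, mul_one]; exact hA) hij h
    exact this
  have cross1 : ∀ i j, Matrix.single i j (1 : ℂ) ∈ W → ∀ k l, k ≠ l →
      Q * Matrix.single k l (1 : ℂ) * Q ∈ W := by
    intro i j h k l hkl
    refine key2 _ h k l hkl ?_
    rw [mul_single_mul_apply]
    exact mul_ne_zero (hne _ _) (hne _ _)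
  have cross2 : ∀ i j, Q * Matrix.single i j (1 : ℂ) * Q ∈ W → ∀ k l, k ≠ l →
      Matrix.single k l (1 : ℂ) ∈ W := by
    intro i j h k l hkl
    refine single_mem hd hW h hkl ?_
    rw [mul_single_mul_apply]
    exact mul_ne_zero (hne _ _) (hne _ _)
  have ex : ∃ i j, Q * Matrix.single i j (1 : ℂ) * Q ∈ W := by
    by_cases hoff : ∃ i j, i ≠ j ∧ B i j ≠ 0
    · obtain ⟨i, j, hij, h⟩ := hoff
      exact ⟨i, j, cross1 i j (single_mem hd hW hB hij h) i j hij⟩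
    · push Not at hoff
      have hBd : B = diagonal (fun i => B i i) := by
        ext i j
        by_cases hij : i = j
        · subst hij; simp
        · rw [hoff i j hij, diagonal_apply_ne _ hij]
      by_contra hcon
      push Not at hcon
      have hz : ∀ k l, k ≠ l → (Q * diagonal (fun i => B i i) * Q) k l = 0 := by
        intro k l hkl
        by_contra h
        rw [← hBd] at h
        exact hcon k l (key2 B hB k l hkl h)
      have hc := diag_scalar_of hQ hne hz
      apply hBs (B 0 0)
      rw [hBd]
      ext i j
      simp only [Matrix.smul_apply, Matrix.one_apply, diagonal_apply, smul_eq_mul]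
      by_cases hij : i = j
      · subst hij; simpa using hc i 0
      · simp [hij]
  obtain ⟨i, j, hij⟩ := ex
  have all1 := cross2 i j hij
  have all2 := cross1 0 1 (all1 0 1 (by decide))
  by_contra hAW
  obtain ⟨φ, hφA, hφW⟩ := Submodule.exists_le_ker_of_notMem hAW
  set c : Fin 4 → ℂ := fun i => φ (Matrix.single i i 1) with hc
  have hφ : ∀ A : M4, φ A = ∑ i, c i * A i i := by
    intro A
    conv_lhs => rw [matrix_eq_sum_single A]
    simp only [map_sum]
    refine Finset.sum_congr rfl fun i _ => ?_
    have hsm : ∀ j, φ (Matrix.single i j (A i j)) = A i j * φ (Matrix.single i j 1) := by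
      intro j
      rw [← smul_eq_mul, ← map_smul, Matrix.smul_single, smul_eq_mul, mul_one]
    rw [Finset.sum_eq_single i]
    · rw [hsm, mul_comm]
    · intro j _ hji
      rw [hsm, LinearMap.mem_ker.mp (hφW (all1 i j hji.symm)), mul_zero]
    · simp
  have hz : ∀ k l, k ≠ l → (Q * diagonal c * Q) k l = 0 := by
    intro k l hkl
    have h := LinearMap.mem_ker.mp (hφW (all2 l k hkl.symm))
    rw [hφ] at h
    rw [mul_apply, ← h]
    refine Finset.sum_congr rfl fun i _ => ?_
    rw [mul_single_mul_apply, mul_diagonal]; ring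
  have hcs := diag_scalar_of hQ hne hz
  apply hφA
  rw [hφ]
  have : ∀ i, c i * A i i = c 0 * A i i := fun i => by rw [hcs i 0]
  simp only [this, ← Finset.mul_sum]
  have htr : ∑ i, A i i = A.trace := rfl
  rw [htr, hA, mul_zero]

theorem S_mul_S : S * S = 1 := by
  ext i j
  fin_cases i <;> fin_cases j <;> simp [S, mul_apply, Fin.sum_univ_four]

theorem star_S : star S = S := by
  ext i j
  fin_cases i <;> fin_cases j <;> simp [S, star_apply]

/-- Irreducibility. -/
theorem irr {N : ℕ} {V : M4} (hV : V ∈ unitary M4) {d : Fin 4 → ℂ} (hd : GoodD N d)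
    (hGV : GoodV V) {g : M4} (hg : g = V * diagonal d * star V) {W : Submodule ℂ M4}
    (hW : ∀ A ∈ W, g * A * star g ∈ W)
    (hW2 : ∀ A ∈ W, (S * g * S) * A * star (S * g * S) ∈ W)
    {B : M4} (hB : B ∈ W) (hBs : ∀ c : ℂ, B ≠ c • 1) {A : M4} (hA : A.trace = 0) : A ∈ W := by
  let f : M4 →ₗ[ℂ] M4 := (LinearMap.mulRight ℂ (star V)).comp (LinearMap.mulLeft ℂ V)
  have hf : ∀ A, f A = V * A * star V := fun A => rfl
  have hl : ∀ X : M4, star V * (V * X) = X := fun X => by rw [← mul_assoc, hV.1, one_mul]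
  have hr : ∀ X : M4, V * (star V * X) = X := fun X => by rw [← mul_assoc, hV.2, one_mul]
  have hs : ∀ X : M4, S * (S * X) = X := fun X => by rw [← mul_assoc, S_mul_S, one_mul]
  have hinv : ∀ A, V * (star V * A * V) * star V = A := by
    intro A
    simp only [mul_assoc, hr, hV.2, mul_one]
  have main : star V * A * V ∈ W.comap f := by
    refine irr_core hd (Q := star V * S * V) ?_ hGV (W := W.comap f) ?_ ?_
      (B := star V * B * V) ?_ ?_ ?_
    · simp only [mul_assoc, hr, hs, hV.1]
    · intro X hX
      have := hW _ hX
      change V * (diagonal d * X * star (diagonal d)) * star V ∈ W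
      rw [hf] at this
      convert this using 1
      rw [hg]
      simp only [star_mul, star_star, mul_assoc, hl]
    · intro X hX
      have := hW2 _ hX
      change V * ((star V * S * V) * (diagonal d * X * star (diagonal d)) * (star V * S * V)) * star V ∈ W
      rw [hf] at this
      convert this using 1
      rw [hg]
      simp only [star_mul, star_star, star_S, mul_assoc, hl, hr, hs, hV.2, mul_one]
    · change V * (star V * B * V) * star V ∈ W
      rw [hinv]; exact hB
    · intro c hc
      apply hBs c
      rw [← hinv B, hc]
      simp [hV.2]
    · rw [Matrix.trace_mul_comm, ← mul_assoc, hV.2, one_mul, hA]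
  have := main
  change V * (star V * A * V) * star V ∈ W at this
  rwa [hinv] at this

theorem isCompact_unitary : IsCompact (unitary M4 : Set M4) := by
  refine Metric.isCompact_of_isClosed_isBounded isClosed_unitary ?_
  refine (Metric.isBounded_closedBall (x := (0 : M4)) (r := 1)).subset fun V hV => ?_
  rw [mem_closedBall_zero_iff, norm_u hV]

theorem norm_u_mul {V : M4} (hV : V ∈ unitary M4) (A : M4) : ‖V * A‖ = ‖A‖ :=
  CStarRing.norm_mem_unitary_mul A hV

theorem norm_mul_u {V : M4} (hV : V ∈ unitary M4) (A : M4) : ‖A * V‖ = ‖A‖ :=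
  CStarRing.norm_mul_mem_unitary A hV

/-- Uniform recurrence of powers near the identity. -/
theorem exists_pow_near : ∃ N : ℕ, ∀ g ∈ unitary M4, ∃ n, 1 ≤ n ∧ n ≤ N ∧ ‖g ^ n - 1‖ < 1 / 4 := by
  obtain ⟨t, -, htf, hcov⟩ := isCompact_unitary.finite_cover_balls (e := 1 / 8) (by norm_num)
  refine ⟨htf.toFinset.card, fun g hg => ?_⟩
  have hx : ∀ n : ℕ, ∃ x ∈ t, g ^ n ∈ Metric.ball x (1 / 8) := by
    intro n
    have := hcov (pow_mem hg n : g ^ n ∈ unitary M4)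
    simpa using this
  choose x hxt hxb using hx
  obtain ⟨a, ha, b, hb, hab, hxab⟩ := Finset.exists_ne_map_eq_of_card_lt_of_maps_to
    (s := Finset.range (htf.toFinset.card + 1)) (t := htf.toFinset) (by simp) (f := x)
    (fun n _ => by simpa using hxt n)
  have main : ∀ a b : ℕ, a < b → b < htf.toFinset.card + 1 → x a = x b →
      ∃ n, 1 ≤ n ∧ n ≤ htf.toFinset.card ∧ ‖g ^ n - 1‖ < 1 / 4 := by
    intro a b hab hb hx
    refine ⟨b - a, by omega, by omega, ?_⟩
    have h1 : g ^ b - g ^ a = g ^ a * (g ^ (b - a) - 1) := by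
      rw [mul_sub, ← pow_add, mul_one]; congr 2; omega
    rw [← norm_u_mul (pow_mem hg a), ← h1, ← dist_eq_norm]
    have h2 := hxb a
    have h3 := hxb b
    rw [hx] at h2
    rw [Metric.mem_ball] at h2 h3
    calc _ ≤ dist (g ^ b) (x b) + dist (g ^ a) (x b) := dist_triangle_right _ _ _
      _ < 1 / 4 := by linarith
  simp only [Finset.mem_range] at ha hb
  rcases lt_or_gt_of_ne hab with h | h
  · exact main a b h hb hxab
  · exact main b a h ha hxab.symm

theorem pow_conj_diag {V : M4} (hV : V ∈ unitary M4) (d : Fin 4 → ℂ) (n : ℕ) :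
    (V * diagonal d * star V) ^ n = V * diagonal (d ^ n) * star V := by
  induction n with
  | zero => simp [hV.2]
  | succ n ih =>
    rw [pow_succ, ih, pow_succ]
    have : V * diagonal (d ^ n) * star V * (V * diagonal d * star V) =
      V * (diagonal (d ^ n) * (star V * V) * diagonal d) * star V := by noncomm_ring
    rw [this, hV.1, mul_one, diagonal_mul_diagonal]
    rfl

theorem pow_not_scalar {N : ℕ} {V : M4} (hV : V ∈ unitary M4) {d : Fin 4 → ℂ} (hd : GoodD N d)
    {n : ℕ} (h1 : 1 ≤ n) (h2 : n ≤ N) (c : ℂ) : (V * diagonal d * star V) ^ n ≠ c • 1 := by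
  rw [pow_conj_diag hV]
  intro h
  have h3 : diagonal (d ^ n) = c • (1 : M4) := by
    calc diagonal (d ^ n) = (star V * V) * diagonal (d ^ n) * (star V * V) := by
          rw [hV.1, one_mul, mul_one]
      _ = star V * (V * diagonal (d ^ n) * star V) * V := by noncomm_ring
      _ = c • (1 : M4) := by rw [h]; simp [hV.1]
  have e0 := congrFun (congrFun h3 0) 0
  have e1 := congrFun (congrFun h3 1) 1
  simp at e0 e1
  exact hd.2 n h1 h2 0 1 (by decide) (e0.trans e1.symm)

/-- Near-identity conjugates commute when noncentral elements stay away from `1`. -/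
theorem commute_of_gap {K : Set M4} (hK : ClosedGrp K) {δ : ℝ}
    (hδ : ∀ k ∈ K, ‖k - 1‖ < δ → ∃ c : ℂ, k = c • 1) {a b : M4} (ha : a ∈ K) (hb : b ∈ K)
    {r : ℝ} (ha1 : ‖a - 1‖ ≤ r) (hb1 : ‖b - 1‖ ≤ r) (hr : r < 1 / 4) (hr2 : r < 2 * δ) :
    a * b = b * a := by
  have hr0 : 0 ≤ r := (norm_nonneg _).trans ha1
  have hau := hK.unit ha
  have hbu := hK.unit hb
  set c : M4 := a * b * (star a * star b) with hc
  have hcK : c ∈ K := hK.mul (hK.mul ha hb) (hK.mul (hK.star ha) (hK.star hb))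
  have e1 : c * (b * a) = a * b := by
    have : c * (b * a) = a * b * (star a * (star b * b) * a) := by rw [hc]; noncomm_ring
    rw [this, hbu.1, mul_one, hau.1, mul_one]
  have e2 : ‖c - 1‖ ≤ 2 * (r * r) := by
    have : (c - 1) * (b * a) = (a - 1) * (b - 1) - (b - 1) * (a - 1) := by
      rw [sub_mul, e1]; noncomm_ring
    rw [← norm_mul_u (mul_mem hbu hau), this]
    calc _ ≤ ‖(a - 1) * (b - 1)‖ + ‖(b - 1) * (a - 1)‖ := norm_sub_le _ _
      _ ≤ ‖a - 1‖ * ‖b - 1‖ + ‖b - 1‖ * ‖a - 1‖ :=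
        add_le_add (norm_mul_le _ _) (norm_mul_le _ _)
      _ ≤ r * r + r * r := by gcongr
      _ = _ := by ring
  have e3 : ‖c - 1‖ < δ := by nlinarith
  obtain ⟨z, hz⟩ := hδ c hcK e3
  have hdet := hK.det hcK
  rw [hz, det_smul, det_one, mul_one, Fintype.card_fin] at hdet
  have hzn : ‖z - 1‖ < 1 := by
    have : c - 1 = (z - 1) • (1 : M4) := by rw [hz, sub_smul, one_smul]
    rw [this, norm_smul, norm_one, mul_one] at e2
    nlinarith
  have hz1 : z = 1 := by
    have hf : (z - 1) * ((z + 1) * (z ^ 2 + 1)) = 0 := by linear_combination hdet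
    rcases mul_eq_zero.mp hf with h | h
    · exact sub_eq_zero.mp h
    exfalso
    rcases mul_eq_zero.mp h with h | h
    · have : z - 1 = -2 := by linear_combination h
      rw [this] at hzn
      norm_num at hzn
    · have h4 : (z - Complex.I) * (z + Complex.I) = 0 := by
        linear_combination h - Complex.I_sq
      have hre : z.re = 0 := by
        rcases mul_eq_zero.mp h4 with h | h
        · rw [sub_eq_zero.mp h]; simp
        · rw [eq_neg_of_add_eq_zero_left h]; simp
      have := Complex.abs_re_le_norm (z - 1)
      rw [Complex.sub_re, hre] at this
      norm_num at this
      linarith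
  rw [hz, hz1, one_smul, one_mul] at e1
  exact e1.symm

/-- A noncommutativity fact used to exclude the discrete case. -/
theorem discrete_case {N : ℕ}
    (hN : ∀ g ∈ unitary M4, ∃ n, 1 ≤ n ∧ n ≤ N ∧ ‖g ^ n - 1‖ < 1 / 4)
    {K : Set M4} (hK : ClosedGrp K) {V : M4} (hV : V ∈ unitary M4) {d : Fin 4 → ℂ}
    (hd : GoodD N d) (hGV : GoodV V) (hg : V * diagonal d * star V ∈ K)
    (hg' : S * (V * diagonal d * star V) * S ∈ K) :
    ∀ ε > 0, ∃ h ∈ K, (∀ c : ℂ, h ≠ c • 1) ∧ ‖h - 1‖ < ε := by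
  by_contra hcon
  push Not at hcon
  obtain ⟨ε, hε, hcon⟩ := hcon
  set T : Set ℝ := {r | ∃ h ∈ K, (∀ c : ℂ, h ≠ c • 1) ∧ ‖h - 1‖ = r} with hT
  obtain ⟨n, hn1, hn2, hn3⟩ := hN _ (hK.unit hg)
  have hnT : ‖(V * diagonal d * star V) ^ n - 1‖ ∈ T :=
    ⟨_, hK.pow hg n, pow_not_scalar hV hd hn1 hn2, rfl⟩
  have hbdd : BddBelow T := ⟨0, by rintro _ ⟨h, -, -, rfl⟩; exact norm_nonneg _⟩
  set δ := sInf T with hδ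
  have hδε : ε ≤ δ := by
    refine le_csInf ⟨_, hnT⟩ ?_
    rintro _ ⟨h, h1, h2, rfl⟩
    exact hcon h h1 h2
  have hδ4 : δ < 1 / 4 := (csInf_le hbdd hnT).trans_lt hn3
  obtain ⟨_, ⟨h, hhK, hhs, rfl⟩, hlt⟩ : ∃ r ∈ T, r < min (2 * δ) (1 / 4) :=
    exists_lt_of_csInf_lt ⟨_, hnT⟩ (lt_min (by linarith) hδ4)
  have hgap : ∀ k ∈ K, ‖k - 1‖ < δ → ∃ c : ℂ, k = c • 1 := by
    intro k hk hkδ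
    by_contra hc
    push Not at hc
    exact absurd (csInf_le hbdd ⟨k, hk, hc, rfl⟩) (not_le.mpr hkδ)
  set C : Set M4 := {A | ∃ k ∈ K, A = k * h * star k} with hC
  have hCK : ∀ A ∈ C, A ∈ K ∧ ‖A - 1‖ ≤ ‖h - 1‖ := by
    rintro _ ⟨k, hk, rfl⟩
    refine ⟨hK.mul (hK.mul hk hhK) (hK.star hk), ?_⟩
    have hku := hK.unit hk
    have : k * h * star k - 1 = k * (h - 1) * star k := by
      rw [mul_sub, sub_mul, mul_one, hku.2]
    rw [this, norm_mul_u (Unitary.star_mem hku), norm_u_mul hku]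
  have hcomm : ∀ A ∈ C, ∀ B ∈ C, A * B = B * A := by
    intro A hA B hB
    exact commute_of_gap hK hgap (hCK A hA).1 (hCK B hB).1 (hCK A hA).2 (hCK B hB).2
      (hlt.trans_le (min_le_right _ _)) (hlt.trans_le (min_le_left _ _))
  set W : Submodule ℂ M4 := Submodule.span ℂ C with hW
  have hinv : ∀ k ∈ K, ∀ A ∈ W, k * A * star k ∈ W := by
    intro k hk A hA
    induction hA using Submodule.span_induction with
    | mem A hA =>
      obtain ⟨l, hl, rfl⟩ := hA
      refine Submodule.subset_span ⟨k * l, hK.mul hk hl, ?_⟩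
      rw [star_mul]; noncomm_ring
    | zero => simp
    | add x y _ _ hx hy => rw [mul_add, add_mul]; exact W.add_mem hx hy
    | smul c x _ hx => rw [mul_smul_comm, smul_mul_assoc]; exact W.smul_mem c hx
  have hWc : ∀ A ∈ W, ∀ B ∈ W, A * B = B * A := by
    intro A hA B hB
    induction hA using Submodule.span_induction with
    | mem A hA =>
      induction hB using Submodule.span_induction with
      | mem B hB => exact hcomm A hA B hB
      | zero => simp
      | add x y _ _ hx hy => rw [mul_add, add_mul, hx, hy]
      | smul c x _ hx => rw [mul_smul_comm, smul_mul_assoc, hx]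
    | zero => simp
    | add x y _ _ hx hy => rw [mul_add, add_mul, hx, hy]
    | smul c x _ hx => rw [mul_smul_comm, smul_mul_assoc, hx]
  have hhW : h ∈ W := Submodule.subset_span ⟨1, hK.one, by simp⟩
  have hall : ∀ A : M4, A.trace = 0 → A ∈ W := fun A hA =>
    irr hV hd hGV rfl (hinv _ hg) (hinv _ hg') hhW hhs hA
  have e01 := hall (Matrix.single 0 1 1) (Matrix.trace_single_eq_of_ne _ _ _ (by decide))
  have e10 := hall (Matrix.single 1 0 1) (Matrix.trace_single_eq_of_ne _ _ _ (by decide))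
  have := hWc _ e01 _ e10
  rw [Matrix.single_mul_single_same, Matrix.single_mul_single_same] at this
  have := congrFun (congrFun this 0) 0
  simp at this

theorem group_full {N : ℕ}
    (hN : ∀ g ∈ unitary M4, ∃ n, 1 ≤ n ∧ n ≤ N ∧ ‖g ^ n - 1‖ < 1 / 4)
    {K : Set M4} (hK : ClosedGrp K) {V : M4} (hV : V ∈ unitary M4) {d : Fin 4 → ℂ}
    (hd : GoodD N d) (hGV : GoodV V) (hg : V * diagonal d * star V ∈ K)
    (hg' : S * (V * diagonal d * star V) * S ∈ K) :
    ∀ A ∈ unitary M4, A.det = 1 → A ∈ K := by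
  have hacc := discrete_case hN hK hV hd hGV hg hg'
  obtain ⟨X, hX, hX0⟩ := lieSub_nontrivial hK (fun ε hε => by
    obtain ⟨h, h1, h2, h3⟩ := hacc ε hε
    exact ⟨h, h1, fun h4 => h2 1 (by rw [h4, one_smul]), h3⟩)
  -- the complexification
  let W : Submodule ℂ M4 :=
    { carrier := {A | ∃ P ∈ lieSub hK, ∃ R ∈ lieSub hK, A = P + Complex.I • R}
      zero_mem' := ⟨0, Submodule.zero_mem _, 0, Submodule.zero_mem _, by simp⟩
      add_mem' := by
        rintro _ _ ⟨P, hP, R, hR, rfl⟩ ⟨P', hP', R', hR', rfl⟩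
        exact ⟨P + P', Submodule.add_mem _ hP hP', R + R', Submodule.add_mem _ hR hR', by
          rw [smul_add]; abel⟩
      smul_mem' := by
        rintro c _ ⟨P, hP, R, hR, rfl⟩
        refine ⟨c.re • P - c.im • R, Submodule.sub_mem _ (Submodule.smul_mem _ _ hP)
          (Submodule.smul_mem _ _ hR), c.re • R + c.im • P, Submodule.add_mem _
          (Submodule.smul_mem _ _ hR) (Submodule.smul_mem _ _ hP), ?_⟩
        ext i j
        simp only [Matrix.smul_apply, Matrix.add_apply, Matrix.sub_apply, smul_eq_mul,
          Complex.real_smul]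
        conv_lhs => rw [← Complex.re_add_im c]
        linear_combination (c.im * R i j) * Complex.I_sq }
  have hmem : ∀ A, A ∈ W ↔ ∃ P ∈ lieSub hK, ∃ R ∈ lieSub hK, A = P + Complex.I • R :=
    fun A => Iff.rfl
  have hinv : ∀ k ∈ K, ∀ A ∈ W, k * A * star k ∈ W := by
    intro k hk A hA
    obtain ⟨P, hP, R, hR, rfl⟩ := (hmem _).mp hA
    refine (hmem _).mpr ⟨_, lieSub_conj hK hk hP, _, lieSub_conj hK hk hR, ?_⟩
    rw [mul_add, add_mul, mul_smul_comm, smul_mul_assoc]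
  have hXW : X ∈ W := (hmem _).mpr ⟨X, hX, 0, Submodule.zero_mem _, by simp⟩
  have hXs : ∀ c : ℂ, X ≠ c • 1 := by
    rintro c rfl
    have := lieSub_scalar hK hX
    rw [this, zero_smul] at hX0
    exact hX0 rfl
  have hall : ∀ A : M4, A.trace = 0 → A ∈ W := fun A hA =>
    irr hV hd hGV rfl (hinv _ hg) (hinv _ hg') hXW hXs hA
  intro A hA hAd
  obtain ⟨Y, hYs, hYt, rfl⟩ := exists_log_trace hA hAd
  obtain ⟨P, hP, R, hR, hPR⟩ := (hmem _).mp (hall Y hYt)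
  have hYP : Y = P := by
    have h1 : star Y = -P + Complex.I • R := by
      rw [hPR, star_add, star_smul, hP.1, hR.1]; simp
    rw [hYs, hPR] at h1
    have h3 : Complex.I • R = 0 := by
      have : (2 : ℂ) • (Complex.I • R) = 0 := by
        rw [two_smul]
        have h4 : Complex.I • R = -(Complex.I • R) := by
          have := congrArg (fun Z => Z + P) h1
          simp only [neg_add] at this
          have h5 : -P + -(Complex.I • R) + P = -(Complex.I • R) := by abel
          have h6 : -P + Complex.I • R + P = Complex.I • R := by abel
          rw [h5, h6] at this
          exact this.symm
        nth_rewrite 1 [h4]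
        exact neg_add_cancel _
      exact (smul_eq_zero.mp this).resolve_left two_ne_zero
    rw [hPR, h3, add_zero]
  have := hP.2 1
  rwa [one_smul, ← hYP] at this

theorem goodD_inj {N : ℕ} {d : Fin 4 → ℂ} (hd : GoodD N d) {i j : Fin 4} (h : d i = d j) :
    i = j := by
  by_contra hij
  exact hd.1 i j i i hij (by simpa using Ne.symm hij) (by rw [h])

theorem good_unique {N : ℕ} {V₀ V₁ : M4} (h₀ : V₀ ∈ unitary M4) (h₁ : V₁ ∈ unitary M4)
    {d₀ d₁ : Fin 4 → ℂ} (hd : GoodD N d₀) (hV : GoodV V₀)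
    (h : V₀ * diagonal d₀ * star V₀ = V₁ * diagonal d₁ * star V₁) :
    GoodD N d₁ ∧ GoodV V₁ := by
  set M : M4 := star V₀ * V₁ with hM
  have hMu : M ∈ unitary M4 := mul_mem (Unitary.star_mem h₀) h₁
  have hVM : V₁ = V₀ * M := by rw [hM, ← mul_assoc, h₀.2, one_mul]
  have hcomm : diagonal d₀ * M = M * diagonal d₁ := by
    calc diagonal d₀ * M = (star V₀ * V₀) * diagonal d₀ * (star V₀ * V₁) := by
          rw [h₀.1, one_mul]
      _ = star V₀ * (V₀ * diagonal d₀ * star V₀) * V₁ := by noncomm_ring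
      _ = star V₀ * V₁ * diagonal d₁ * (star V₁ * V₁) := by rw [h]; noncomm_ring
      _ = M * diagonal d₁ := by rw [h₁.1, mul_one]
  have hent : ∀ i j, M i j ≠ 0 → d₀ i = d₁ j := by
    intro i j hne
    have := congrFun (congrFun hcomm i) j
    rw [mul_diagonal, diagonal_mul, mul_comm] at this
    exact mul_left_cancel₀ hne this
  have hcol : ∀ j, ∃ i, M i j ≠ 0 := by
    intro j
    by_contra hcon
    push Not at hcon
    have := congrFun (congrFun hMu.1 j) j
    rw [mul_apply] at this
    simp [hcon] at this
  choose σ hσ using hcol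
  have hzero : ∀ i j, i ≠ σ j → M i j = 0 := by
    intro i j hij
    by_contra hne
    exact hij (goodD_inj hd ((hent i j hne).trans (hent _ j (hσ j)).symm))
  have hσinj : Function.Injective σ := by
    intro a b hab
    by_contra hne
    have := congrFun (congrFun hMu.1 a) b
    rw [mul_apply, Finset.sum_eq_single (σ a), Matrix.one_apply_ne hne, star_apply] at this
    · rcases mul_eq_zero.mp this with h | h
      · exact hσ a (by simpa using h)
      · rw [hab] at h; exact hσ b h
    · intro i _ hi
      rw [hzero i b (hab ▸ hi), mul_zero]
    · simp
  have hd1 : ∀ j, d₁ j = d₀ (σ j) := fun j => (hent _ j (hσ j)).symm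
  refine ⟨⟨?_, ?_⟩, ?_⟩
  · intro i j k l hij hijkl
    rw [hd1, hd1, hd1, hd1]
    refine hd.1 _ _ _ _ (hσinj.ne hij) ?_
    intro heq
    obtain ⟨e1, e2⟩ := Prod.mk.inj heq
    exact hijkl (by rw [hσinj e1, hσinj e2])
  · intro n h1 h2 i j hij
    rw [hd1, hd1]
    exact hd.2 n h1 h2 _ _ (hσinj.ne hij)
  · intro i j
    have : star V₁ * S * V₁ = star M * (star V₀ * S * V₀) * M := by
      rw [hVM, star_mul]; noncomm_ring
    rw [this, mul_apply, Finset.sum_eq_single (σ j), mul_apply, Finset.sum_eq_single (σ i)]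
    · refine mul_ne_zero (mul_ne_zero ?_ (hV _ _)) (hσ j)
      rw [star_apply]
      simpa using hσ i
    · intro b _ hb
      rw [star_apply, hzero b i hb]; simp
    · simp
    · intro b _ hb
      rw [hzero b j hb, mul_zero]
    · simp

theorem isOpen_goodD (N : ℕ) : IsOpen {d | GoodD N d} := by
  rw [isOpen_iff_eventually]
  intro d hd
  have hc : ∀ i, Continuous (fun d : Fin 4 → ℂ => d i) := fun i => continuous_apply i
  refine Eventually.and ?_ ?_
  · simp only [eventually_all]
    intro i j k l hij hijkl
    exact (isOpen_ne_fun (by fun_prop : Continuous fun d : Fin 4 → ℂ => d i * star (d j))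
      (by fun_prop : Continuous fun d : Fin 4 → ℂ => d k * star (d l))).mem_nhds
      (hd.1 i j k l hij hijkl)
  · have := (Filter.eventually_all_finite (Set.finite_Icc 1 N) (l := 𝓝 d)
      (p := fun n d => ∀ i j, i ≠ j → d i ^ n ≠ d j ^ n)).mpr (by
        intro n hn
        simp only [eventually_all]
        intro i j hij
        exact (isOpen_ne_fun (by fun_prop : Continuous fun d : Fin 4 → ℂ => d i ^ n)
          (by fun_prop : Continuous fun d : Fin 4 → ℂ => d j ^ n)).mem_nhds
          (hd.2 n hn.1 hn.2 i j hij))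
    filter_upwards [this] with d hd n h1 h2
    exact hd n ⟨h1, h2⟩

theorem isOpen_goodV : IsOpen {V | GoodV V} := by
  have : {V | GoodV V} = ⋂ i, ⋂ j, {V : M4 | (star V * S * V) i j ≠ 0} := by
    ext V; simp [GoodV]
  rw [this]
  refine isOpen_iInter_of_finite fun i => isOpen_iInter_of_finite fun j => ?_
  refine isOpen_ne.preimage (f := fun V : M4 => (star V * S * V) i j) ?_
  have h : Continuous fun V : M4 => star V * S * V := by fun_prop
  exact h.matrix_elem i j

/-- The bad set of diagonalizations. -/
def Bad (N : ℕ) : Set (M4 × (Fin 4 → ℂ)) :=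
  ((unitary M4 : Set M4) ×ˢ (Set.univ.pi fun _ => Metric.sphere (0 : ℂ) 1)) ∩
    {p | GoodD N p.2 ∧ GoodV p.1}ᶜ

theorem isCompact_bad (N : ℕ) : IsCompact (Bad N) := by
  refine (isCompact_unitary.prod (isCompact_univ_pi fun _ => isCompact_sphere _ _)).inter_right ?_
  rw [isClosed_compl_iff]
  exact ((isOpen_goodD N).preimage continuous_snd).inter (isOpen_goodV.preimage continuous_fst)

def assemble (p : M4 × (Fin 4 → ℂ)) : M4 := p.1 * diagonal p.2 * star p.1

theorem continuous_assemble : Continuous assemble := by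
  have h : Continuous fun p : M4 × (Fin 4 → ℂ) => (diagonal p.2 : M4) :=
    continuous_snd.matrix_diagonal
  unfold assemble
  exact (continuous_fst.mul h).mul continuous_fst.star

theorem continuous_toMat : Continuous toMat := continuous_subtype_val.comp continuous_subtype_val

theorem toMat_mem (g : SU4) : toMat g ∈ unitary M4 := g.1.2
theorem toMat_det (g : SU4) : (toMat g).det = 1 := g.2

def goodSet (N : ℕ) : Set SU4 := {g | toMat g ∉ assemble '' Bad N}

theorem isOpen_goodSet (N : ℕ) : IsOpen (goodSet N) :=
  (((isCompact_bad N).image continuous_assemble).isClosed.isOpen_compl).preimage continuous_toMat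

theorem eventually_exp_ne {a : ℂ} (ha : a ≠ 0) {m : ℝ} (hm : m ≠ 0) (c : ℂ) :
    ∀ᶠ s : ℝ in 𝓝[≠] 0, a * Complex.exp (Complex.I * (m * s)) ≠ c := by
  have hd : HasDerivAt (fun s : ℝ => a * Complex.exp (Complex.I * (m * s)))
      (a * (Complex.I * m)) 0 := by
    have h1 : HasDerivAt (fun s : ℝ => Complex.I * ((m : ℂ) * (s:ℂ))) (Complex.I * (m * 1)) 0 :=
      ((Complex.ofRealCLM.hasDerivAt).const_mul (m : ℂ)).const_mul Complex.I
    have := (h1.cexp).const_mul a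
    simpa using this
  exact hd.eventually_ne (mul_ne_zero ha (mul_ne_zero Complex.I_ne_zero (by exact_mod_cast hm)))

/-- A Golomb-type exponent vector with sum zero. -/
def bz : Fin 4 → ℤ := ![-11, -7, 5, 13]

noncomputable def pathD (d : Fin 4 → ℂ) (s : ℝ) : Fin 4 → ℂ :=
  fun i => d i * Complex.exp (Complex.I * (((bz i : ℝ) : ℂ) * s))

theorem eventually_goodD (N : ℕ) {d : Fin 4 → ℂ} (hd : ∀ i, d i ≠ 0) :
    ∀ᶠ s : ℝ in 𝓝[≠] 0, GoodD N (pathD d s) := by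
  refine Eventually.and ?_ ?_
  · simp only [eventually_all]
    intro i j k l hij hijkl
    have hm : bz i - bz j - bz k + bz l ≠ 0 := by
      revert i j k l; decide
    have hm' : ((bz i - bz j - bz k + bz l : ℤ) : ℝ) ≠ 0 := by exact_mod_cast hm
    filter_upwards [eventually_exp_ne (mul_ne_zero (hd i) (star_ne_zero.mpr (hd j))) hm'
      (d k * star (d l))] with s hs heq
    apply hs
    simp only [pathD, star_mul', Complex.star_def, ← Complex.exp_conj] at heq
    simp only [map_mul, Complex.conj_I, Complex.conj_ofReal] at heq
    have e1 : Complex.exp (Complex.I * (((bz i - bz j - bz k + bz l : ℤ) : ℝ) * s)) =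
        Complex.exp (Complex.I * (((bz i : ℝ) : ℂ) * s)) *
        Complex.exp (-Complex.I * (((bz j : ℝ) : ℂ) * s)) *
        Complex.exp (-(Complex.I * (((bz k : ℝ) : ℂ) * s) + -Complex.I * (((bz l : ℝ) : ℂ) * s))) := by
      rw [← Complex.exp_add, ← Complex.exp_add]
      congr 1
      push_cast
      ring
    rw [e1]
    have e2 : Complex.exp (Complex.I * (((bz k : ℝ) : ℂ) * s)) *
        Complex.exp (-Complex.I * (((bz l : ℝ) : ℂ) * s)) *
        Complex.exp (-(Complex.I * (((bz k : ℝ) : ℂ) * s) + -Complex.I * (((bz l : ℝ) : ℂ) * s))) = 1 := by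
      rw [← Complex.exp_add, ← Complex.exp_add, add_neg_cancel, Complex.exp_zero]
    rw [Complex.star_def]
    set E := Complex.exp (-(Complex.I * (((bz k : ℝ) : ℂ) * s) + -Complex.I * (((bz l : ℝ) : ℂ) * s)))
    linear_combination E * heq + (d k * (starRingEnd ℂ) (d l)) * e2
  · have := (Filter.eventually_all_finite (Set.finite_Icc 1 N) (l := 𝓝[≠] (0:ℝ))
      (p := fun n s => ∀ i j, i ≠ j → pathD d s i ^ n ≠ pathD d s j ^ n)).mpr (by
        intro n hn
        simp only [eventually_all]
        intro i j hij
        have hm : (n : ℤ) * (bz i - bz j) ≠ 0 := by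
          refine mul_ne_zero (by have := hn.1; omega) ?_
          revert i j; decide
        have hm' : (((n : ℤ) * (bz i - bz j) : ℤ) : ℝ) ≠ 0 := by exact_mod_cast hm
        filter_upwards [eventually_exp_ne (pow_ne_zero n (hd i)) hm' (d j ^ n)] with s hs heq
        apply hs
        simp only [pathD, mul_pow, ← Complex.exp_nat_mul] at heq
        have e1 : Complex.exp (Complex.I * ((((n : ℤ) * (bz i - bz j) : ℤ) : ℝ) * s)) =
            Complex.exp (n * (Complex.I * (((bz i : ℝ) : ℂ) * s))) *
            Complex.exp (-(n * (Complex.I * (((bz j : ℝ) : ℂ) * s)))) := by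
          rw [← Complex.exp_add]
          congr 1
          push_cast
          ring
        rw [e1, ← mul_assoc, heq, mul_assoc, ← Complex.exp_add, add_neg_cancel, Complex.exp_zero,
          mul_one])
    filter_upwards [this] with s hs n h1 h2
    exact hs n ⟨h1, h2⟩

noncomputable def V1 : M4 :=
  ((1 + Complex.I) / 2) • !![1, -1, 0, 0; 1, 1, 0, 0; 0, 0, -1, -1; 0, 0, 1, -1]

theorem V1_coeff : (1 + -Complex.I) / 2 * ((1 + Complex.I) / 2) = 1 / 2 := by
  linear_combination (-1/4 : ℂ) * Complex.I_sq

theorem V1_unitary : V1 ∈ unitary M4 := by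
  have h : star V1 * V1 = 1 := by
    unfold V1
    rw [star_smul, smul_mul_smul_comm]
    have hc : star ((1 + Complex.I) / 2) * ((1 + Complex.I) / 2) = 1 / 2 := by
      rw [← V1_coeff]; simp
    rw [hc]
    ext i j
    fin_cases i <;> fin_cases j <;>
      simp [mul_apply, Fin.sum_univ_four, Matrix.one_apply] <;> norm_num
  exact ⟨h, mul_eq_one_comm.mp h⟩

theorem V1_good : GoodV V1 := by
  have hc : star ((1 + Complex.I) / 2) * ((1 + Complex.I) / 2) = 1 / 2 := by
    rw [← V1_coeff]; simp
  intro i j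
  unfold V1
  rw [star_smul, smul_mul_assoc, smul_mul_smul_comm, hc, Matrix.smul_apply]
  refine smul_ne_zero (by norm_num) ?_
  fin_cases i <;> fin_cases j <;> simp [S, mul_apply, Fin.sum_univ_four]

theorem eventually_goodV {V X : M4} (hV : V ∈ unitary M4) (hX : star X = -X)
    (hVX : exp X = star V * V1) : ∀ᶠ s : ℝ in 𝓝[≠] 0, GoodV (V * exp (s • X)) := by
  simp only [GoodV, eventually_all]
  intro i j
  set f : ℝ → ℂ := fun s => (star (V * exp (s • X)) * S * (V * exp (s • X))) i j with hf
  have hexp : ∀ Y : M4, AnalyticOnNhd ℝ (fun s : ℝ => exp (s • Y)) Set.univ := by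
    intro Y s _
    have h1 : AnalyticAt ℝ (fun s : ℝ => s • Y) s := analyticAt_id.smul analyticAt_const
    exact AnalyticAt.comp (f := fun s : ℝ => s • Y) (g := (NormedSpace.exp : M4 → M4)) (x := s)
      (NormedSpace.exp_analytic (𝕂 := ℝ) (s • Y)) h1
  have hfa : AnalyticOnNhd ℝ f Set.univ := by
    have h1 : AnalyticOnNhd ℝ (fun s : ℝ => exp (s • (-X)) * (star V * S * V) * exp (s • X))
        Set.univ := ((hexp (-X)).mul analyticOnNhd_const).mul (hexp X)
    let L : M4 →L[ℝ] ℂ := (Matrix.entryLinearMap ℝ ℂ i j).toContinuousLinearMap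
    have h2 : f = fun s => L (exp (s • (-X)) * (star V * S * V) * exp (s • X)) := by
      funext s
      change _ = (exp (s • (-X)) * (star V * S * V) * exp (s • X)) i j
      simp only [hf]
      rw [star_mul, star_exp, star_smul, hX, star_trivial]
      congr 2
      noncomm_ring
    rw [h2]
    exact L.comp_analyticOnNhd h1
  rcases (hfa 0 (Set.mem_univ _)).eventually_eq_zero_or_eventually_ne_zero with h | h
  · exfalso
    have h1 := hfa.eqOn_zero_of_preconnected_of_eventuallyEq_zero isPreconnected_univ
      (Set.mem_univ 0) h (Set.mem_univ 1)
    simp only [hf, one_smul, Pi.zero_apply] at h1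
    have e : V * (star V * V1) = V1 := by rw [← mul_assoc, hV.2, one_mul]
    rw [hVX, e] at h1
    exact V1_good i j h1
  · exact h

theorem dense_goodSet (N : ℕ) : Dense (goodSet N) := by
  intro g
  obtain ⟨V, hV, θ, hg⟩ := exists_diag (toMat_mem g)
  set d : Fin 4 → ℂ := fun i => Complex.exp (Complex.I * θ i) with hd
  obtain ⟨X, hX, hVX⟩ := exists_log (mul_mem (Unitary.star_mem hV) V1_unitary)
  have hdn : ∀ i, ‖d i‖ = 1 := fun i => by
    rw [hd]; simp only; rw [mul_comm]; exact Complex.norm_exp_ofReal_mul_I _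
  have hpn : ∀ s i, pathD d s i * star (pathD d s i) = 1 := by
    intro s i
    rw [Complex.star_def, Complex.mul_conj, Complex.normSq_eq_norm_sq]
    simp only [pathD, norm_mul, hdn]
    rw [mul_comm Complex.I, ← Complex.ofReal_mul, Complex.norm_exp_ofReal_mul_I]
    simp
  have hDu : ∀ s, (diagonal (pathD d s) : M4) ∈ unitary M4 := by
    intro s
    have : diagonal (pathD d s) * star (diagonal (pathD d s) : M4) = 1 := by
      rw [star_eq_conjTranspose, diagonal_conjTranspose, diagonal_mul_diagonal, ← diagonal_one]
      congr 1
      funext i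
      exact hpn s i
    exact ⟨mul_eq_one_comm.mp this, this⟩
  have hWu : ∀ s : ℝ, V * exp (s • X) ∈ unitary M4 := fun s =>
    mul_mem hV (exp_skew_mem (skew_smul hX s))
  have hdet0 : ∏ i, d i = 1 := by
    have h1 := congrArg Matrix.det hg
    rw [toMat_det, det_mul, mul_comm, ← det_mul, ← mul_assoc, hV.1, one_mul, det_diagonal] at h1
    exact h1.symm
  have hdets : ∀ s, ∏ i, pathD d s i = 1 := by
    intro s
    simp only [pathD, Finset.prod_mul_distrib, hdet0, one_mul, ← Complex.exp_sum]
    rw [← Complex.exp_zero]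
    congr 1
    simp [Fin.sum_univ_four, bz]
    ring
  let A : ℝ → M4 := fun s => assemble (V * exp (s • X), pathD d s)
  have hAu : ∀ s, A s ∈ unitary M4 := fun s =>
    mul_mem (mul_mem (hWu s) (hDu s)) (Unitary.star_mem (hWu s))
  have hAd : ∀ s, (A s).det = 1 := by
    intro s
    change (V * exp (s • X) * diagonal (pathD d s) * star (V * exp (s • X))).det = 1
    rw [det_mul, mul_comm, ← det_mul, ← mul_assoc, (hWu s).1, one_mul, det_diagonal, hdets]
  let γ : ℝ → SU4 := fun s => ⟨⟨A s, hAu s⟩, hAd s⟩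
  have hγA : ∀ s, toMat (γ s) = A s := fun s => rfl
  have hAc : Continuous A := by
    refine continuous_assemble.comp (Continuous.prodMk ?_ ?_)
    · exact continuous_const.mul (NormedSpace.exp_continuous.comp (by fun_prop))
    · unfold pathD
      fun_prop
  have hγc : Continuous γ := (hAc.subtype_mk _).subtype_mk _
  have hγ0 : γ 0 = g := by
    apply Subtype.ext
    apply Subtype.ext
    change A 0 = toMat g
    rw [hg]
    change V * exp ((0:ℝ) • X) * diagonal (pathD d 0) * star (V * exp ((0:ℝ) • X)) = _
    have : pathD d 0 = d := by funext i; simp [pathD]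
    rw [this, zero_smul, exp_zero, mul_one]
  have hlim : Tendsto γ (𝓝[≠] 0) (𝓝 g) := by
    have := (hγc.tendsto 0).mono_left (nhdsWithin_le_nhds (s := {0}ᶜ))
    rwa [hγ0] at this
  refine mem_closure_of_tendsto hlim ?_
  have hd0 : ∀ i, d i ≠ 0 := fun i => Complex.exp_ne_zero _
  filter_upwards [eventually_goodD N hd0, eventually_goodV hV hX hVX] with s h1 h2
  rintro ⟨⟨V', d'⟩, ⟨⟨hV', -⟩, hbad⟩, heq⟩
  exact hbad (good_unique (hWu s) hV' h1 h2 heq.symm)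

theorem isClosedEmbedding_toMat : IsClosedEmbedding toMat := by
  have h1 : IsClosedEmbedding (Subtype.val : unitary M4 → M4) :=
    isClosed_unitary.isClosedEmbedding_subtypeVal
  have h2 : IsClosed (SU4 : Set (Matrix.unitaryGroup (Fin 4) ℂ)) := by
    have : Continuous fun g : Matrix.unitaryGroup (Fin 4) ℂ => (g : M4).det :=
      continuous_subtype_val.matrix_det
    exact isClosed_singleton.preimage this
  exact h1.comp h2.isClosedEmbedding_subtypeVal

theorem closedGrp_of (H : Subgroup SU4) : ClosedGrp (toMat '' (H.topologicalClosure : Set SU4)) where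
  closed := isClosedEmbedding_toMat.isClosedMap _ H.isClosed_topologicalClosure
  one := ⟨1, one_mem _, rfl⟩
  mul := by
    rintro _ _ ⟨a, ha, rfl⟩ ⟨b, hb, rfl⟩
    exact ⟨a * b, mul_mem ha hb, rfl⟩
  star := by
    rintro _ ⟨a, ha, rfl⟩
    exact ⟨a⁻¹, inv_mem ha, rfl⟩
  unit := by
    rintro _ ⟨a, ha, rfl⟩
    exact toMat_mem a
  det := by
    rintro _ ⟨a, ha, rfl⟩
    exact toMat_det a

theorem exists_swap_conj (g : SU4) : ∃ g' : SU4, toMat g' = S * toMat g * S := by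
  have hS : S ∈ unitary M4 := ⟨by rw [star_S, S_mul_S], by rw [star_S, S_mul_S]⟩
  refine ⟨⟨⟨S * toMat g * S, mul_mem (mul_mem hS (toMat_mem g)) hS⟩, ?_⟩, rfl⟩
  change (S * toMat g * S).det = 1
  rw [det_mul, mul_comm, ← det_mul, ← mul_assoc, S_mul_S, one_mul, toMat_det]

theorem dense_of_good {N : ℕ}
    (hN : ∀ g ∈ unitary M4, ∃ n, 1 ≤ n ∧ n ≤ N ∧ ‖g ^ n - 1‖ < 1 / 4)
    {g g' : SU4} (hg : g ∈ goodSet N) (hg' : toMat g' = S * toMat g * S) :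
    Dense ((Subgroup.closure {g, g'} : Subgroup SU4) : Set SU4) := by
  obtain ⟨V, hV, θ, hgd⟩ := exists_diag (toMat_mem g)
  set d : Fin 4 → ℂ := fun i => Complex.exp (Complex.I * θ i) with hd
  have hgood : GoodD N d ∧ GoodV V := by
    by_contra hbad
    refine hg ⟨(V, d), ⟨⟨hV, fun i _ => ?_⟩, hbad⟩, hgd.symm⟩
    rw [mem_sphere_zero_iff_norm]
    change ‖Complex.exp (Complex.I * θ i)‖ = 1
    rw [mul_comm]; exact Complex.norm_exp_ofReal_mul_I _
  set H := Subgroup.closure {g, g'} with hH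
  have hsub := H.le_topologicalClosure
  have h1 : toMat g ∈ toMat '' (H.topologicalClosure : Set SU4) :=
    ⟨g, hsub (Subgroup.subset_closure (by simp)), rfl⟩
  have h2 : toMat g' ∈ toMat '' (H.topologicalClosure : Set SU4) :=
    ⟨g', hsub (Subgroup.subset_closure (by simp)), rfl⟩
  rw [hg', hgd] at h2
  rw [hgd] at h1
  have hall := group_full hN (closedGrp_of H) hV hgood.1 hgood.2 h1 h2
  intro x
  obtain ⟨y, hy, hyx⟩ := hall (toMat x) (toMat_mem x) (toMat_det x)
  rw [isClosedEmbedding_toMat.injective hyx] at hy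
  exact hy

end


/-- there is an open dense subset O ⊆ SU(4) such that for every g ∈ O,
g' = S g S again lies in SU(4), and the image in PU(4) = SU(4)/Z(SU(4)) of the subgroup
of SU(4) generated by {g, g'} is dense in PU(4) (with the quotient topology). -/
theorem exists_open_dense_universal_gates :
    ∃ O : Set ↥SU4, IsOpen O ∧ Dense O ∧
      ∀ g ∈ O, ∃ g' : ↥SU4, toMat g' = S * toMat g * S ∧
        Dense ((QuotientGroup.mk '' ((Subgroup.closure {g, g'} : Subgroup ↥SU4) :
          Set ↥SU4)) : Set PU4) := by
  obtain ⟨N, hN⟩ := exists_pow_near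
  refine ⟨goodSet N, isOpen_goodSet N, dense_goodSet N, fun g hg => ?_⟩
  obtain ⟨g', hg'⟩ := exists_swap_conj g
  refine ⟨g', hg', ?_⟩
  exact (QuotientGroup.mk_surjective.denseRange).dense_image QuotientGroup.continuous_mk
    (dense_of_good hN hg hg')
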